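/- There exists no order-preserving bijection T : c → c₀ such that T⁻¹ is Lipschitz continuous. Here c denotes the Banach space of convergent real sequences and c₀ the space of real sequences converging to 0, both with the supremum norm and the coordinatewise partial order, and T order-preserving means x ≤ y implies Tx ≤ Ty. -/

import Mathlib

open Filter

/-- The space `c` of convergent real sequences (as a subtype of `ℕ → ℝ`). -/
def ConvSeq : Type := {x : ℕ → ℝ // ∃ l : ℝ, Filter.Tendsto x Filter.atTop (nhds l)}

/-- The space `c₀` of real sequences converging to `0` (as a subtype of `ℕ → ℝ`). -/
def NullSeq : Type := {y : ℕ → ℝ // Filter.Tendsto y Filter.atTop (nhds 0)}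

/-- There is no order-preserving bijection `T : c → c₀` whose inverse is Lipschitz
(with respect to the supremum norms and the coordinatewise orders). -/
theorem stmt_4 :
    ¬ ∃ (T : ConvSeq → NullSeq) (S : NullSeq → ConvSeq),
      (∀ x, S (T x) = x) ∧ (∀ y, T (S y) = y) ∧
      (∀ x x' : ConvSeq, x.1 ≤ x'.1 → (T x).1 ≤ (T x').1) ∧
      (∃ L : ℝ, 0 ≤ L ∧ ∀ u v : NullSeq,
        (⨆ n : ℕ, |(S u).1 n - (S v).1 n|) ≤ L * ⨆ n : ℕ, |u.1 n - v.1 n|) := by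
  rintro ⟨T, S, hST, -, hmono, L, hL, hLip⟩
  have he : ∀ k : ℕ, Filter.Tendsto (fun n : ℕ => if n = k then (1:ℝ) else 0) Filter.atTop (nhds 0) := by
    intro k
    refine tendsto_const_nhds.congr' ?_
    filter_upwards [Filter.eventually_gt_atTop k] with n hn
    rw [if_neg (by omega)]
  let e : ℕ → ConvSeq := fun k => ⟨fun n => if n = k then (1:ℝ) else 0, 0, he k⟩
  let z : ConvSeq := ⟨fun _ => 0, 0, tendsto_const_nhds⟩
  let o : ConvSeq := ⟨fun _ => 1, 1, tendsto_const_nhds⟩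
  have hz : ∀ k, (T z).1 ≤ (T (e k)).1 := fun k => hmono _ _ (by
    intro n; simp only [z, e]; split_ifs <;> norm_num)
  have ho : ∀ k, (T (e k)).1 ≤ (T o).1 := fun k => hmono _ _ (by
    intro n; simp only [o, e]; split_ifs <;> norm_num)
  obtain ⟨a, -, φ, hφ, hlim⟩ := (isCompact_Icc (a := (T z).1) (b := (T o).1)).tendsto_subseq
    (x := fun k => (T (e k)).1) (fun k => ⟨hz k, ho k⟩)
  have hε : (0:ℝ) < 1 / (L + 1) := by positivity
  have hd : Filter.Tendsto (fun n => (T o).1 n - (T z).1 n) Filter.atTop (nhds 0) := by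
    simpa using (T o).2.sub (T z).2
  obtain ⟨N, hN⟩ := Filter.eventually_atTop.1 (hd.eventually (gt_mem_nhds hε))
  have hev : ∀ᶠ k in Filter.atTop, ∀ n ∈ Finset.range N,
      |(T (e (φ k))).1 n - (T (e (φ (k+1)))).1 n| < 1 / (L + 1) := by
    rw [Filter.eventually_all_finset]
    intro n _
    have h1 := (tendsto_pi_nhds.1 hlim) n
    have h2 := h1.comp (Filter.tendsto_add_atTop_nat 1)
    have h3 := (h1.sub h2).abs
    rw [sub_self, abs_zero] at h3
    exact h3.eventually (gt_mem_nhds hε)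
  obtain ⟨k, hk⟩ := hev.exists
  have hsup : (⨆ n : ℕ, |(T (e (φ k))).1 n - (T (e (φ (k+1)))).1 n|) ≤ 1 / (L + 1) := by
    refine ciSup_le fun n => ?_
    by_cases hn : n < N
    · exact (hk n (Finset.mem_range.2 hn)).le
    · have := hN n (by omega)
      have a1 := hz (φ k) n
      have a2 := ho (φ k) n
      have a3 := hz (φ (k+1)) n
      have a4 := ho (φ (k+1)) n
      rw [abs_le]
      constructor <;> linarith
  have hne : φ k ≠ φ (k+1) := (hφ (Nat.lt_succ_self k)).ne
  have hone : 1 ≤ ⨆ n : ℕ, |(e (φ k)).1 n - (e (φ (k+1))).1 n| := by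
    have hb : BddAbove (Set.range fun n : ℕ => |(e (φ k)).1 n - (e (φ (k+1))).1 n|) := by
      refine ⟨1, ?_⟩
      rintro _ ⟨n, rfl⟩
      simp only [e]
      split_ifs <;> norm_num
    refine le_trans ?_ (le_ciSup hb (φ k))
    simp [e, hne]
  have h := hLip (T (e (φ k))) (T (e (φ (k+1))))
  rw [hST, hST] at h
  have h2 := mul_le_mul_of_nonneg_left hsup hL
  have h3 : L * (1 / (L + 1)) < 1 := by
    rw [mul_one_div, div_lt_one (by positivity)]
    linarith
  linarith
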